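/- arXiv:2410.16495 — 2 statements merged into one kernel-verified Lean document; each statement's English description precedes it below -/
import Mathlib

section
/- For all positive integers r, s, t there are positive integers f = f(r,s,t) and g = g(r,s,t) with the following property. Let G be a graph and let M = (A_1,…,A_f; B_1,…,B_g) be an induced (f,g)-model in G. Then one of the following holds: (a) there is an A-linear induced (s,t)-model M' = (A_1',…,A_s'; B_1',…,B_t') in G such that for every i ∈ {1,…,t} we have B_i' ∈ {B_1,…,B_g}; or (b) G has an induced minor isomorphic to a 1-subdivision of K_r. -/
open SimpleGraph

/-- Two vertex sets `X` and `Y` are *anticomplete* in `G` if they are disjoint and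
there is no edge of `G` with an end in each. -/
def Anticomplete {V : Type} (G : SimpleGraph V) (X Y : Set V) : Prop :=
  Disjoint X Y ∧ ∀ x ∈ X, ∀ y ∈ Y, ¬ G.Adj x y

/-- `G` has an induced subgraph isomorphic to `H`. -/
def HasInducedSubgraphIso {V W : Type} (G : SimpleGraph V) (H : SimpleGraph W) : Prop :=
  ∃ X : Set V, Nonempty (H ≃g G.induce X)

/-- `G` has an induced minor isomorphic to `H`, witnessed by branch sets. -/
def HasInducedMinor {V W : Type} (G : SimpleGraph V) (H : SimpleGraph W) : Prop :=
  ∃ B : W → Set V,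
    (∀ w, (G.induce (B w)).Connected) ∧
    (Pairwise fun u v => Disjoint (B u) (B v)) ∧
    (∀ u v : W, u ≠ v → (H.Adj u v ↔ ¬ Anticomplete G (B u) (B v)))

/-- The set `P` induces a path in `G`. -/
def IsPathSet {V : Type} (G : SimpleGraph V) (P : Set V) : Prop :=
  ∃ n : ℕ, Nonempty (G.induce P ≃g pathGraph (n + 1))

/-- The vertex sets of the connected components of the subgraph of `G` induced on `X`. -/
def CompsOn {V : Type} (G : SimpleGraph V) (X : Set V) : Set (Set V) :=
  {L | ∃ C : (G.induce X).ConnectedComponent, L = Subtype.val '' C.supp}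

/-- The induced subgraph of `G` on `W` together with the stable set `S ⊆ W` forms a
constellation: every component of `W \ S` is a path and every vertex of `S` has a
neighbor in every such component. -/
structure IsConstellationOn {V : Type} (G : SimpleGraph V) (W S : Set V) : Prop where
  subset : S ⊆ W
  stable : ∀ x ∈ S, ∀ y ∈ S, ¬ G.Adj x y
  comp_paths : ∀ L ∈ CompsOn G (W \ S), IsPathSet G L
  dominates : ∀ x ∈ S, ∀ L ∈ CompsOn G (W \ S), ∃ y ∈ L, G.Adj x y

/-- `p` is a route of the constellation `(W, S)` in `G`: an induced path of the induced
subgraph of `G` on `W`, with its two (distinct) ends in `S` and its interior outside `S`. -/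
structure IsRoute {V : Type} (G : SimpleGraph V) (W S : Set V) {x y : V}
    (p : G.Walk x y) : Prop where
  ne : x ≠ y
  isPath : p.IsPath
  induced : ∀ u v, u ∈ p.support → v ∈ p.support → G.Adj u v → p.toSubgraph.Adj u v
  support_mem : ∀ v ∈ p.support, v ∈ W
  fst_mem : x ∈ S
  snd_mem : y ∈ S
  interior : ∀ v ∈ p.support, v ≠ x → v ≠ y → v ∉ S

/-- The constellation `(W, S)` in `G` is `d`-ample: no route has length at most `d+1`. -/
def DAmple {V : Type} (G : SimpleGraph V) (W S : Set V) (d : ℕ) : Prop :=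
  ∀ ⦃x y : V⦄ (p : G.Walk x y), IsRoute G W S p → d + 1 < p.length

/-- The constellation `(W, S)` in `G` is interrupted with respect to some linear order
(encoded by an injective-on-`S` function `f : V → ℕ`). -/
def Interrupted {V : Type} (G : SimpleGraph V) (W S : Set V) : Prop :=
  ∃ f : V → ℕ, Set.InjOn f S ∧
    ∀ x ∈ S, ∀ y ∈ S, ∀ z ∈ S, f x < f y → f y < f z →
      ∀ (p : G.Walk x y), IsRoute G W S p → ∃ v ∈ p.support, G.Adj z v

/-- The constellation `(W, S)` in `G` is `q`-zigzagged. -/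
def Zigzagged {V : Type} (G : SimpleGraph V) (W S : Set V) (q : ℕ) : Prop :=
  ∃ f : V → ℕ, Set.InjOn f S ∧
    ∀ x ∈ S, ∀ y ∈ S, f x < f y →
      ∀ (p : G.Walk x y), IsRoute G W S p →
        {z | z ∈ S ∧ f x < f z ∧ f z < f y ∧ ¬ ∃ v ∈ p.support, G.Adj z v}.ncard < q

/-- The constellation `(W, S)` in `G` is `(qm, q, qp)`-mixed. -/
def Mixed {V : Type} (G : SimpleGraph V) (W S : Set V) (qm q qp : ℕ) : Prop :=
  ∃ f : V → ℕ, Set.InjOn f S ∧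
    ∀ x ∈ S, ∀ y ∈ S, f x < f y →
      ∀ (p : G.Walk x y), IsRoute G W S p →
        ∀ Qm Q Qp : Set V, Qm ⊆ S → Q ⊆ S → Qp ⊆ S →
          Qm.ncard = qm → Q.ncard = q → Qp.ncard = qp →
          (∀ z ∈ Qm, f z < f x) → (∀ z ∈ Q, f x < f z ∧ f z < f y) →
          (∀ z ∈ Qp, f y < f z) →
          ∃ z ∈ Qm ∪ Q ∪ Qp, ∃ v ∈ p.support, G.Adj z v

/-- The constellation `(W', S')` sits in the constellation `(W, S)` (both within `G`). -/
def SitsIn {V : Type} (G : SimpleGraph V) (W' S' W S : Set V) : Prop :=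
  W' ⊆ W ∧ S' ⊆ S ∧
  (∀ L ∈ CompsOn G (W' \ S'), ∃ M ∈ CompsOn G (W \ S), L ⊆ M) ∧
  (∀ M ∈ CompsOn G (W \ S), ∀ L₁ ∈ CompsOn G (W' \ S'), ∀ L₂ ∈ CompsOn G (W' \ S'),
      L₁ ⊆ M → L₂ ⊆ M → L₁ = L₂)

/-- A witness that `S` is a subdivision of `H`, where each edge of `H` is replaced by a
path whose length satisfies `ok`. -/
structure SubdivModel {U W : Type} (S : SimpleGraph U) (H : SimpleGraph W)
    (ok : ℕ → Prop) where
  b : W → U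
  b_inj : Function.Injective b
  path : ∀ ⦃u v : W⦄, H.Adj u v → S.Walk (b u) (b v)
  path_isPath : ∀ ⦃u v : W⦄ (h : H.Adj u v), (path h).IsPath
  path_len : ∀ ⦃u v : W⦄ (h : H.Adj u v), ok (path h).length
  path_symm : ∀ ⦃u v : W⦄ (h : H.Adj u v), path h.symm = (path h).reverse
  branch_avoid : ∀ ⦃u v : W⦄ (h : H.Adj u v) (w : W), b w ∈ (path h).support → w = u ∨ w = v
  interiors_anticomplete :
    ∀ ⦃u v u' v' : W⦄ (h : H.Adj u v) (h' : H.Adj u' v'),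
      (s(u, v) : Sym2 W) ≠ s(u', v') →
      ∀ x ∈ (path h).support, x ≠ b u → x ≠ b v →
      ∀ y ∈ (path h').support, y ≠ b u' → y ≠ b v' →
        x ≠ y ∧ ¬ S.Adj x y
  cover : ∀ x : U, (∃ w, x = b w) ∨ ∃ (u v : W) (h : H.Adj u v), x ∈ (path h).support
  edges_eq : ∀ x y : U, S.Adj x y → ∃ (u v : W) (h : H.Adj u v), (path h).toSubgraph.Adj x y

/-- `S` is a subdivision of `H` with path lengths satisfying `ok`. -/
def IsSubdivisionWith {U W : Type} (S : SimpleGraph U) (H : SimpleGraph W)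
    (ok : ℕ → Prop) : Prop :=
  Nonempty (SubdivModel S H ok)

/-- The line graph of `G`. -/
def LineGraph {V : Type} (G : SimpleGraph V) : SimpleGraph G.edgeSet :=
  SimpleGraph.fromRel (fun e f => ∃ v : V, v ∈ (e : Sym2 V) ∧ v ∈ (f : Sym2 V))

/-- The `r`-by-`r` hexagonal wall (brick wall). -/
def Wall (r : ℕ) : SimpleGraph (Fin r × Fin (2 * r)) :=
  SimpleGraph.fromRel (fun a b =>
    (a.1 = b.1 ∧ a.2.val + 1 = b.2.val) ∨
    (a.2 = b.2 ∧ a.1.val + 1 = b.1.val ∧ (a.1.val + a.2.val) % 2 = 0))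

/-- The full binary tree of radius `r`, on `2^(r+1) - 1` vertices (heap indexing). -/
def BinTree (r : ℕ) : SimpleGraph (Fin (2 ^ (r + 1) - 1)) :=
  SimpleGraph.fromRel (fun a b =>
    b.val + 1 = 2 * (a.val + 1) ∨ b.val + 1 = 2 * (a.val + 1) + 1)

/-- The leaf-extension of `H` by leaves `L` attached via `f`. -/
def leafExt {W : Type} (H : SimpleGraph W) (L : Type) (f : L → W) :
    SimpleGraph (W ⊕ L) :=
  SimpleGraph.fromRel (fun a b =>
    match a, b with
    | Sum.inl a, Sum.inl b => H.Adj a b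
    | Sum.inl a, Sum.inr x => f x = a
    | _, _ => False)

/-- `G` has treewidth at most `k` (via tree decompositions). -/
def TreewidthLE {V : Type} (G : SimpleGraph V) (k : ℕ) : Prop :=
  ∃ (ι : Type) (T : SimpleGraph ι) (bag : ι → Set V),
    T.IsTree ∧
    (∀ v, ∃ i, v ∈ bag i) ∧
    (∀ u v, G.Adj u v → ∃ i, u ∈ bag i ∧ v ∈ bag i) ∧
    (∀ v, (T.induce {i | v ∈ bag i}).Connected) ∧
    (∀ i, (bag i).ncard ≤ k + 1)

/-- `G` has pathwidth at most `k` (via path decompositions). -/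
def PathwidthLE {V : Type} (G : SimpleGraph V) (k : ℕ) : Prop :=
  ∃ (n : ℕ) (bag : Fin n → Set V),
    (∀ v, ∃ i, v ∈ bag i) ∧
    (∀ u v, G.Adj u v → ∃ i, u ∈ bag i ∧ v ∈ bag i) ∧
    (∀ (v : V) (i j k' : Fin n), i ≤ j → j ≤ k' → v ∈ bag i → v ∈ bag k' → v ∈ bag j) ∧
    (∀ i, (bag i).ncard ≤ k + 1)

/-- An induced `(s,t)`-model in `G`. -/
def IsInducedModel {V : Type} (G : SimpleGraph V) {s t : ℕ}
    (A : Fin s → Set V) (B : Fin t → Set V) : Prop :=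
  (∀ i, (G.induce (A i)).Connected) ∧
  (∀ j, (G.induce (B j)).Connected) ∧
  (∀ i j : Fin s, i ≠ j → Anticomplete G (A i) (A j)) ∧
  (∀ i j : Fin t, i ≠ j → Anticomplete G (B i) (B j)) ∧
  (∀ (i : Fin s) (j : Fin t), Disjoint (A i) (B j) ∧ ¬ Anticomplete G (A i) (B j))

/-- The `A`-contraction of a model: each `A i` is contracted to the vertex `Sum.inl i`. -/
def AContraction {V : Type} (G : SimpleGraph V) {s t : ℕ}
    (A : Fin s → Set V) (B : Fin t → Set V) :
    SimpleGraph (Fin s ⊕ (⋃ j, B j : Set V)) :=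
  SimpleGraph.fromRel (fun x y =>
    match x, y with
    | Sum.inl i, Sum.inl i' => i ≠ i' ∧ ∃ a ∈ A i, ∃ a' ∈ A i', G.Adj a a'
    | Sum.inl i, Sum.inr b => ∃ a ∈ A i, G.Adj a ↑b
    | Sum.inr b, Sum.inr b' => G.Adj ↑b ↑b'
    | _, _ => False)

/-- A linear induced model is `d`-`A`-ample if its `A`-contraction is `d`-ample. -/
def ModelAAmple {V : Type} (G : SimpleGraph V) {s t : ℕ}
    (A : Fin s → Set V) (B : Fin t → Set V) (d : ℕ) : Prop :=
  DAmple (AContraction G A B) Set.univ (Set.range Sum.inl) d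

/-- A linear induced model is `d`-ample if it is `d`-`A`-ample and `d`-`B`-ample. -/
def ModelAmple {V : Type} (G : SimpleGraph V) {s t : ℕ}
    (A : Fin s → Set V) (B : Fin t → Set V) (d : ℕ) : Prop :=
  ModelAAmple G A B d ∧ ModelAAmple G B A d

/-- The zigzag sequences. -/
def Zseq : ℕ → List ℤ
  | 0 => []
  | 1 => [1]
  | 2 => [1, 2]
  | 3 => [1, 2, 3]
  | n + 4 =>
      (Zseq (n + 3)).dropLast ++ (((Zseq (n + 2)).map (· + 1)).reverse).dropLast
        ++ (Zseq (n + 3)).map (· + 1)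

/-- Collapse each maximal run of consecutive equal entries to a single entry. -/
def collapse (l : List ℤ) : List ℤ := l.destutter (· ≠ ·)

/-- `B` is an alignment in the sequence `A`. -/
def IsAlignment (A : List ℤ) (B : Finset ℤ) : Prop :=
  (∀ b ∈ B, b ∈ A) ∧
  ∃ i j : ℕ, i ≤ j ∧ j < A.length ∧
    ∀ b ∈ B,
      (collapse (((A.take (j + 1)).drop i).filter (fun a => decide (a ∈ B)))).count b = 1

/-- The vertices of a shortest walk inside a connected set induce a path. -/
theorem exists_isPathSet_subset {V : Type} {G : SimpleGraph V} {A : Set V}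
    (hA : (G.induce A).Connected) {a b : V} (ha : a ∈ A) (hb : b ∈ A) :
    ∃ P ⊆ A, IsPathSet G P ∧ a ∈ P ∧ b ∈ P := by
  obtain ⟨p, hp⟩ := hA.exists_walk_length_eq_dist ⟨a, ha⟩ ⟨b, hb⟩
  have hdist : ∀ i ≤ p.length, (G.induce A).dist ⟨a, ha⟩ (p.getVert i) = i := by
    intro i hi
    have h1 := dist_le (p.take i)
    have h2 := dist_le (p.drop i)
    have h3 := hA.dist_triangle (u := ⟨a, ha⟩) (v := p.getVert i) (w := ⟨b, hb⟩)
    rw [Walk.take_length] at h1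
    rw [Walk.drop_length] at h2
    omega
  set f : Fin (p.length + 1) → V := fun i => (p.getVert i : V) with hf
  have hadj : ∀ i j, G.Adj (f i) (f j) ↔ (pathGraph (p.length + 1)).Adj i j := by
    intro i j
    have hi := hdist i (by omega)
    have hj := hdist j (by omega)
    rw [pathGraph_adj]
    constructor
    · intro h
      have h' : (G.induce A).Adj (p.getVert i) (p.getVert j) := h
      have hd := dist_eq_one_iff_adj.2 h'
      have h1 := hA.dist_triangle (u := ⟨a, ha⟩) (v := p.getVert i) (w := p.getVert j)
      have h2 := hA.dist_triangle (u := ⟨a, ha⟩) (v := p.getVert j) (w := p.getVert i)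
      rw [dist_comm (u := p.getVert j)] at h2
      have hne : (i : ℕ) ≠ j := by
        intro he
        rw [he] at h'
        exact h'.ne rfl
      omega
    · rintro (h | h)
      · have := p.adj_getVert_succ (i := i) (by omega)
        rw [h] at this
        exact this
      · have := p.adj_getVert_succ (i := j) (by omega)
        rw [h] at this
        exact this.symm
  have hinj : Function.Injective f := by
    intro i j hij
    have hi := hdist i (by omega)
    have hj := hdist j (by omega)
    rw [Subtype.ext hij, hj] at hi
    exact Fin.ext hi.symm
  refine ⟨Set.range f, ?_, ⟨p.length, ⟨RelIso.symm
    { toEquiv := Equiv.ofInjective f hinj, map_rel_iff' := ?_ }⟩⟩, ⟨0, ?_⟩, ⟨Fin.last _, ?_⟩⟩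
  · rintro _ ⟨i, rfl⟩
    exact (p.getVert i).2
  · intro i j
    exact hadj i j
  · simp [hf]
  · simp [hf]

theorem IsPathSet.connected {V : Type} {G : SimpleGraph V} {P : Set V} (h : IsPathSet G P) :
    (G.induce P).Connected := by
  obtain ⟨n, ⟨e⟩⟩ := h
  exact e.connected_iff.2 (pathGraph_connected n)

/-- A selection of `r` points avoiding small conflict sets attached to pairs of points,
by a union bound. -/
theorem exists_avoiding_conflicts {r t g : ℕ} (hg : r * r * r * t < g)
    (S : Fin g → Fin g → Finset (Fin g)) (hS : ∀ a b, (S a b).card ≤ t) :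
    ∃ φ : Fin r → Fin g, ∀ j k l, l ≠ j → l ≠ k → φ l ∉ S (φ j) (φ k) := by
  classical
  by_contra! hcon
  let bad : Fin r × Fin r × Fin r → Finset (Fin r → Fin g) := fun q =>
    if q.2.2 ≠ q.1 ∧ q.2.2 ≠ q.2.1 then
      Finset.univ.filter fun φ => φ q.2.2 ∈ S (φ q.1) (φ q.2.1) else ∅
  have hbad : ∀ q, (bad q).card ≤ t * g ^ (r - 1) := by
    rintro ⟨j, k, l⟩
    by_cases hl : l ≠ j ∧ l ≠ k
    · let ρ : (Fin r → Fin g) → ({i : Fin r // i ≠ l} → Fin g) := fun φ i => φ i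
      have h1 := Finset.card_le_mul_card_image (f := ρ) (bad (j, k, l)) t (by
        intro ψ _
        refine le_trans (Finset.card_le_card_of_injOn (fun φ => φ l) ?_ ?_)
          (hS (ψ ⟨j, hl.1.symm⟩) (ψ ⟨k, hl.2.symm⟩))
        · intro φ hφ
          simp only [bad, hl, ne_eq, not_false_eq_true, and_self, if_true, Finset.coe_filter,
            Finset.mem_filter, Finset.mem_univ, true_and, Set.mem_ofPred_eq] at hφ
          obtain ⟨h, rfl⟩ := hφ
          exact h
        · intro φ hφ φ' hφ' h
          simp only [Finset.coe_filter, Set.mem_ofPred_eq] at hφ hφ'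
          funext i
          by_cases hi : i = l
          · rw [hi]; exact h
          · exact congrFun (hφ.2.trans hφ'.2.symm) ⟨i, hi⟩)
      refine h1.trans (Nat.mul_le_mul_left _ ?_)
      refine (Finset.card_le_univ _).trans (le_of_eq ?_)
      simp
    · simp [bad, hl]
  have hcover : (Finset.univ : Finset (Fin r → Fin g)) ⊆ Finset.univ.biUnion bad := by
    intro φ _
    obtain ⟨j, k, l, h1, h2, h3⟩ := hcon φ
    simp only [Finset.mem_biUnion, Finset.mem_univ, true_and]
    exact ⟨(j, k, l), by simp [bad, h1, h2, h3]⟩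
  have hcard := (Finset.card_le_card hcover).trans
    (Finset.card_biUnion_le_card_mul _ _ _ fun q _ => hbad q)
  simp only [Finset.card_univ, Fintype.card_fun, Fintype.card_fin, Fintype.card_prod] at hcard
  rcases Nat.eq_zero_or_pos r with rfl | hr
  · simp at hcard
  · obtain ⟨n, rfl⟩ := Nat.exists_eq_add_of_lt hr
    have hpos : 0 < g ^ n := pow_pos (by omega) n
    have := Nat.mul_lt_mul_of_pos_right hg hpos
    simp only [zero_add, Nat.add_sub_cancel, pow_succ] at hcard this
    nlinarith

/-- A connected set touching many sets either contains a path touching `t` of them, or there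
are `r` of them such that each pair is joined by a connected subset avoiding the others. -/
theorem exists_path_or_pairwise_links {V : Type} {G : SimpleGraph V} {r t g : ℕ}
    (hg : r * r * r * t < g) {A : Set V} {B : Fin g → Set V} (hA : (G.induce A).Connected)
    (hAB : ∀ j, Disjoint A (B j) ∧ ¬ Anticomplete G A (B j)) :
    (∃ y : Fin t → Fin g, Function.Injective y ∧
      ∃ P ⊆ A, IsPathSet G P ∧ ∀ j, ¬ Anticomplete G P (B (y j))) ∨
    (∃ φ : Fin r → Fin g, Function.Injective φ ∧ ∀ e : Sym2 (Fin r), ∃ C ⊆ A,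
      (G.induce C).Connected ∧ ∀ l, ¬ Anticomplete G C (B (φ l)) ↔ l ∈ e) := by
  classical
  have hnbr : ∀ j, ∃ a ∈ A, ∃ b ∈ B j, G.Adj a b := by
    intro j
    by_contra! h
    exact (hAB j).2 ⟨(hAB j).1, h⟩
  choose a haA b hb hab using hnbr
  choose P hPA hP haP hbP using fun j k => exists_isPathSet_subset hA (haA j) (haA k)
  let S : Fin g → Fin g → Finset (Fin g) := fun j k =>
    Finset.univ.filter fun l => ¬ Anticomplete G (P j k) (B l)
  have hS : ∀ {j k l}, l ∈ S j k ↔ ¬ Anticomplete G (P j k) (B l) := by simp [S]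
  have hfst : ∀ j k, j ∈ S j k := fun j k =>
    hS.2 fun h => h.2 _ (haP j k) _ (hb j) (hab j)
  have hsnd : ∀ j k, k ∈ S j k := fun j k =>
    hS.2 fun h => h.2 _ (hbP j k) _ (hb k) (hab k)
  by_cases hlarge : ∃ j k, t ≤ (S j k).card
  · left
    obtain ⟨j, k, hjk⟩ := hlarge
    obtain ⟨T, hT, hTc⟩ := Finset.exists_subset_card_eq hjk
    refine ⟨fun i => T.orderEmbOfFin hTc i, (T.orderEmbOfFin hTc).injective,
      P j k, hPA j k, hP j k, fun i => hS.1 (hT (Finset.orderEmbOfFin_mem _ _ _))⟩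
  · right
    push Not at hlarge
    obtain ⟨φ, hφ⟩ := exists_avoiding_conflicts hg S fun j k => (hlarge j k).le
    refine ⟨φ, ?_, ?_⟩
    · intro j k hjk
      by_contra hne
      refine hφ j j k (Ne.symm hne) (Ne.symm hne) ?_
      rw [← hjk]
      exact hfst _ _
    · intro e
      induction e with
      | _ j k =>
        refine ⟨P (φ j) (φ k), hPA _ _, (hP _ _).connected, fun l => ?_⟩
        rw [← hS, Sym2.mem_iff]
        constructor
        · intro h
          by_contra! hl
          exact hφ j k l hl.1 hl.2 h
        · rintro (rfl | rfl)
          · exact hfst _ _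
          · exact hsnd _ _

/-- A graph whose edges are exactly the incidences between the vertices and the edges of a
complete graph is a 1-subdivision of that complete graph. -/
theorem isSubdivisionWith_two_of_incidence {U W : Type} (H : SimpleGraph U)
    (c : U ≃ W ⊕ {e : Sym2 W // ¬ e.IsDiag})
    (hH : ∀ x y, H.Adj x y ↔ ∃ w e, w ∈ e.1 ∧
      (c x = .inl w ∧ c y = .inr e ∨ c x = .inr e ∧ c y = .inl w)) :
    IsSubdivisionWith H (⊤ : SimpleGraph W) (fun n => n = 2) := by
  let mid : ∀ u v : W, u ≠ v → U := fun u v h => c.symm (.inr ⟨s(u, v), by simpa using h⟩)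
  have hl : ∀ u v h, H.Adj (c.symm (.inl u)) (mid u v h) := fun u v h =>
    (hH _ _).2 ⟨u, ⟨s(u, v), by simpa using h⟩, by simp, .inl (by simp [mid])⟩
  have hr : ∀ u v h, H.Adj (mid u v h) (c.symm (.inl v)) := fun u v h =>
    (hH _ _).2 ⟨v, ⟨s(u, v), by simpa using h⟩, by simp, .inr (by simp [mid])⟩
  have hmid : ∀ u v h w, mid u v h ≠ c.symm (.inl w) := fun u v h w => by simp [mid]
  have hcongr : ∀ {x y m m' : U} (h₁ : H.Adj x m) (h₂ : H.Adj m y) (h₁' : H.Adj x m')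
      (h₂' : H.Adj m' y), m = m' →
      (Walk.cons h₁ (Walk.cons h₂ Walk.nil) : H.Walk x y) =
        Walk.cons h₁' (Walk.cons h₂' Walk.nil) := by
    rintro x y m _ _ _ _ _ rfl
    rfl
  refine ⟨{
    b := fun w => c.symm (.inl w)
    b_inj := fun u v h => by simpa using h
    path := fun u v h => Walk.cons (hl u v h.ne) (Walk.cons (hr u v h.ne) Walk.nil)
    path_isPath := ?_
    path_len := fun u v h => by simp
    path_symm := ?_
    branch_avoid := ?_
    interiors_anticomplete := ?_
    cover := ?_
    edges_eq := ?_ }⟩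
  · intro u v h
    simp [Walk.cons_isPath_iff, hmid, (hmid _ _ _ _).symm, h.ne]
  · intro u v h
    simp only [Walk.reverse_cons, Walk.reverse_nil, Walk.nil_append, Walk.cons_append]
    exact hcongr _ _ _ _ (by simp [mid, Sym2.eq_swap])
  · intro u v h w hw
    simpa [(hmid _ _ _ _).symm] using hw
  · intro u v u' v' h h' hne x hx hxu hxv y hy hyu hyv
    have hx' : x = mid u v h.ne := by simpa [hxu, hxv] using hx
    have hy' : y = mid u' v' h'.ne := by simpa [hyu, hyv] using hy
    subst hx' hy'
    refine ⟨fun he => hne (by simpa [mid] using he), fun he => ?_⟩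
    obtain ⟨w, e, -, h | h⟩ := (hH _ _).1 he <;> simp [mid] at h
  · intro x
    obtain ⟨z, rfl⟩ := c.symm.surjective x
    rcases z with w | ⟨e, he⟩
    · exact .inl ⟨w, rfl⟩
    · induction e with
      | _ u v =>
        have huv : u ≠ v := by simpa using he
        exact .inr ⟨u, v, huv, by simp [mid]⟩
  · intro x y hxy
    obtain ⟨w, ⟨e, he⟩, hwe, h⟩ := (hH _ _).1 hxy
    obtain ⟨v, rfl⟩ := hwe
    have hwv : w ≠ v := by simpa using he
    refine ⟨w, v, hwv, ?_⟩
    rcases h with ⟨hx, hy⟩ | ⟨hx, hy⟩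
    · rw [← Equiv.eq_symm_apply] at hx hy
      subst hx hy
      simp [mid]
    · rw [← Equiv.eq_symm_apply] at hx hy
      subst hx hy
      refine Subgraph.Adj.symm ?_
      simp [mid]

theorem Anticomplete.symm {V : Type} {G : SimpleGraph V} {X Y : Set V}
    (h : Anticomplete G X Y) : Anticomplete G Y X :=
  ⟨h.1.symm, fun y hy x hx hadj => h.2 x hx y hy hadj.symm⟩

theorem Anticomplete.mono {V : Type} {G : SimpleGraph V} {X X' Y Y' : Set V}
    (h : Anticomplete G X Y) (hX : X' ⊆ X) (hY : Y' ⊆ Y) : Anticomplete G X' Y' :=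
  ⟨h.1.mono hX hY, fun x hx y hy => h.2 x (hX hx) y (hY hy)⟩

/-- Pairwise anticomplete sets, together with pairwise anticomplete links each touching exactly
the two ends of its pair, give a 1-subdivided complete graph as an induced minor. -/
theorem exists_subdivision_inducedMinor {V : Type} {G : SimpleGraph V} {r : ℕ}
    (B : Fin r → Set V) (C : {e : Sym2 (Fin r) // ¬ e.IsDiag} → Set V)
    (hB : ∀ j, (G.induce (B j)).Connected) (hC : ∀ e, (G.induce (C e)).Connected)
    (hBB : ∀ j k, j ≠ k → Anticomplete G (B j) (B k))
    (hCC : ∀ e e', e ≠ e' → Anticomplete G (C e) (C e'))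
    (hdisj : ∀ e j, Disjoint (C e) (B j))
    (hCB : ∀ e j, ¬ Anticomplete G (C e) (B j) ↔ j ∈ e.1) :
    ∃ (m : ℕ) (H : SimpleGraph (Fin m)),
      IsSubdivisionWith H (⊤ : SimpleGraph (Fin r)) (fun n => n = 2) ∧
      HasInducedMinor G H := by
  classical
  let c := (Fintype.equivFin (Fin r ⊕ {e : Sym2 (Fin r) // ¬ e.IsDiag})).symm
  let H : SimpleGraph (Fin (Fintype.card (Fin r ⊕ {e : Sym2 (Fin r) // ¬ e.IsDiag}))) :=
    { Adj := fun x y => ∃ w e, w ∈ e.1 ∧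
        (c x = .inl w ∧ c y = .inr e ∨ c x = .inr e ∧ c y = .inl w)
      symm := ⟨by
        rintro x y ⟨w, e, h, h' | h'⟩
        · exact ⟨w, e, h, .inr h'.symm⟩
        · exact ⟨w, e, h, .inl h'.symm⟩⟩
      loopless := ⟨by
        rintro x ⟨w, e, -, ⟨h, h'⟩ | ⟨h, h'⟩⟩ <;> simp [h] at h'⟩ }
  refine ⟨_, H, isSubdivisionWith_two_of_incidence H c fun _ _ => Iff.rfl,
    fun x => Sum.elim B C (c x), ?_, ?_, ?_⟩
  · intro x
    change (G.induce (Sum.elim B C (c x))).Connected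
    cases c x with
    | inl j => exact hB j
    | inr e => exact hC e
  · intro x y hxy
    have hne := c.injective.ne hxy
    revert hne
    dsimp only
    cases c x <;> cases c y <;> intro hne
    · exact (hBB _ _ (by simpa using hne)).1
    · exact (hdisj _ _).symm
    · exact hdisj _ _
    · exact (hCC _ _ (by simpa using hne)).1
  · intro x y hxy
    have hne := c.injective.ne hxy
    revert hne
    change _ → ((∃ w e, w ∈ e.1 ∧ (c x = .inl w ∧ c y = .inr e ∨ c x = .inr e ∧ c y = .inl w)) ↔
      ¬ Anticomplete G (Sum.elim B C (c x)) (Sum.elim B C (c y)))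
    cases c x <;> cases c y <;> intro hne
    · simpa using hBB _ _ (by simpa using hne)
    · rename_i j e
      have : ¬ Anticomplete G (B j) (C e) ↔ j ∈ e.1 :=
        ⟨fun h => (hCB e j).1 fun h' => h h'.symm, fun h h' => (hCB e j).2 h h'.symm⟩
      simp [this, -Subtype.exists]
    · rename_i e j
      simp [hCB e j, -Subtype.exists]
    · simpa using hCC _ _ (by simpa using hne)

/-- Theorem 7.1: for all positive `r, s, t` there are `f, g` such that
for every induced `(f,g)`-model `M = (A; B)` in a graph `G`, either there is an
`A`-linear induced `(s,t)`-model in `G` whose second-side branch sets all belong to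
`{B_1, …, B_g}`, or `G` has an induced minor isomorphic to a 1-subdivision of `K_r`. -/
theorem stmt10 (r s t : ℕ) (hr : 0 < r) (hs : 0 < s) (ht : 0 < t) :
    ∃ f g : ℕ, 0 < f ∧ 0 < g ∧
      ∀ (V : Type) [Fintype V] (G : SimpleGraph V)
        (A : Fin f → Set V) (B : Fin g → Set V),
        IsInducedModel G A B →
          (∃ (A' : Fin s → Set V) (y : Fin t → Fin g),
              IsInducedModel G A' (fun j => B (y j)) ∧ ∀ i, IsPathSet G (A' i)) ∨
          (∃ (m : ℕ) (H : SimpleGraph (Fin m)),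
              IsSubdivisionWith H (⊤ : SimpleGraph (Fin r)) (fun n => n = 2) ∧
              HasInducedMinor G H) := by
  classical
  let g := r * r * r * t + 1
  let E := {e : Sym2 (Fin r) // ¬ e.IsDiag}
  let N := s + Fintype.card E
  let K := (Fin t → Fin g) ⊕ (Fin r → Fin g)
  refine ⟨Fintype.card K * N + 1, g, by omega, by omega, ?_⟩
  intro V _ G A B ⟨hA, hB, hAA, hBB, hAB⟩
  let good : K → Fin (Fintype.card K * N + 1) → Prop := fun κ i =>
    match κ with
    | .inl y => Function.Injective y ∧
        ∃ P ⊆ A i, IsPathSet G P ∧ ∀ j, ¬ Anticomplete G P (B (y j))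
    | .inr φ => Function.Injective φ ∧ ∀ e : Sym2 (Fin r), ∃ C ⊆ A i,
        (G.induce C).Connected ∧ ∀ l, ¬ Anticomplete G C (B (φ l)) ↔ l ∈ e
  have hgood : ∀ i, ∃ κ, good κ i := by
    intro i
    rcases exists_path_or_pairwise_links (r := r) (t := t) (Nat.lt_succ_self _) (hA i) (hAB i)
      with ⟨y, h⟩ | ⟨φ, h⟩
    · exact ⟨.inl y, h⟩
    · exact ⟨.inr φ, h⟩
  choose col hcol using hgood
  obtain ⟨κ, hκ⟩ := Fintype.exists_lt_card_fiber_of_mul_lt_card (f := col) (n := N)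
    (by rw [Fintype.card_fin]; exact Nat.lt_succ_self _)
  have hclass : ∀ (X : Type) [Fintype X], Fintype.card X ≤ N →
      ∃ ι : X → Fin (Fintype.card K * N + 1), Function.Injective ι ∧ ∀ x, good κ (ι x) := by
    intro X _ hX
    obtain ⟨ι⟩ := Function.Embedding.nonempty_of_card_le (α := X)
      (β := {i // i ∈ Finset.univ.filter fun i => col i = κ}) (by
        rw [Fintype.card_coe]; omega)
    refine ⟨fun x => ι x, fun x y h => ι.injective (Subtype.ext h), fun x => ?_⟩
    have hx := (Finset.mem_filter.1 (ι x).2).2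
    have := hcol (ι x)
    rwa [hx] at this
  cases κ with
  | inl y =>
    left
    obtain ⟨ι, hι, h⟩ := hclass (Fin s) (by simp [N])
    choose hy P hPA hP hPB using h
    refine ⟨P, y, ⟨fun i => (hP i).connected, fun j => hB _, fun i j hij => ?_,
      fun i j hij => ?_, fun i j => ⟨?_, hPB i j⟩⟩, hP⟩
    · exact (hAA _ _ (hι.ne hij)).mono (hPA i) (hPA j)
    · exact hBB _ _ ((hy ⟨0, hs⟩).ne hij)
    · exact (hAB _ _).1.mono_left (hPA i)
  | inr φ =>
    right
    obtain ⟨ι, hι, h⟩ := hclass E (by simp [N])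
    obtain ⟨i, hi⟩ := Finset.card_pos.1 ((Nat.zero_le N).trans_lt hκ)
    have hφ : Function.Injective φ := by
      have := hcol i
      rw [(Finset.mem_filter.1 hi).2] at this
      exact this.1
    choose C hCA hC hCB using fun e : E => (h e).2 e.1
    exact exists_subdivision_inducedMinor (fun j => B (φ j)) C (fun j => hB _) hC
      (fun j k hjk => hBB _ _ (hφ.ne hjk))
      (fun e e' he => (hAA _ _ (hι.ne he)).mono (hCA e) (hCA e'))
      (fun e j => (hAB _ _).1.mono_left (hCA e)) hCB
end

section
/- For all positive integers r, s, t there are positive integers f = f(r,s,t) and g = g(r,s,t) with the following property. Let G be a graph and assume there is an induced (f,g)-model in G. Then one of the following holds: (a) there is a linear induced (s,t)-model in G; or (b) G has an induced minor isomorphic to a 1-subdivision of K_r. -/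
open SimpleGraph

/-- If each pair of elements of a large set forbids fewer than `n` elements, then there are `r`
distinct elements none of which is forbidden by a pair of the others. -/
theorem exists_free_injection (r n g : ℕ) (hr : 0 < r) (hg : r * (r * r * (n + 1)) < g)
    (F : Fin g → Fin g → Finset (Fin g)) (hF : ∀ a b, (F a b).card ≤ n) :
    ∃ φ : Fin r → Fin g, Function.Injective φ ∧
      ∀ a b c, c ≠ a → c ≠ b → φ c ∉ F (φ a) (φ b) := by
  classical
  by_contra! hcon
  let S : (c : Fin r) → ({j // j ≠ c} → Fin g) → Finset (Fin g) := fun c ψ =>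
    Finset.univ.biUnion fun p : {j // j ≠ c} × {j // j ≠ c} =>
      insert (ψ p.1) (F (ψ p.1) (ψ p.2))
  have card_S : ∀ c ψ, (S c ψ).card ≤ r * r * (n + 1) := by
    intro c ψ
    refine (Finset.card_biUnion_le_card_mul _ _ (n + 1) ?_).trans ?_
    · intro p _
      exact (Finset.card_insert_le _ _).trans (Nat.succ_le_succ (hF _ _))
    · refine Nat.mul_le_mul_right _ ?_
      rw [Finset.card_univ, Fintype.card_prod]
      have : Fintype.card {j // j ≠ c} ≤ r := by
        simp
      exact Nat.mul_le_mul this this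
  let bad : Fin r → Finset (Fin r → Fin g) := fun c =>
    Finset.univ.filter fun φ => φ c ∈ S c fun j => φ j
  have card_bad : ∀ c, (bad c).card ≤ r * r * (n + 1) * g ^ (r - 1) := by
    intro c
    let T : Finset (Σ _ : {j // j ≠ c} → Fin g, Fin g) := Finset.univ.sigma (S c)
    have h : (bad c).card ≤ T.card := by
      refine Finset.card_le_card_of_injOn (fun φ => ⟨fun j => φ j, φ c⟩) ?_ ?_
      · intro φ hφ
        simpa [T, bad] using hφ
      · intro φ _ φ' _ h
        simp only [Sigma.mk.injEq, heq_eq_eq] at h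
        funext j
        by_cases hj : j = c
        · rw [hj]; exact h.2
        · exact congrFun h.1 ⟨j, hj⟩
    refine h.trans ?_
    rw [Finset.card_sigma]
    refine (Finset.sum_le_card_nsmul _ _ _ fun ψ _ => card_S c ψ).trans ?_
    simp [mul_comm]
  have cover : (Finset.univ : Finset (Fin r → Fin g)) ⊆ Finset.univ.biUnion bad := by
    intro φ _
    simp only [Finset.mem_biUnion, Finset.mem_univ, true_and, bad, Finset.mem_filter, S,
      Finset.mem_insert]
    by_cases hφ : Function.Injective φ
    · obtain ⟨a, b, c, hca, hcb, h⟩ := hcon φ hφ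
      exact ⟨c, (⟨a, hca.symm⟩, ⟨b, hcb.symm⟩), Or.inr h⟩
    · simp only [Function.Injective, not_forall] at hφ
      obtain ⟨a, c, h, hne⟩ := hφ
      exact ⟨c, (⟨a, hne⟩, ⟨a, hne⟩), Or.inl h.symm⟩
  have h₁ := (Finset.card_le_card cover).trans
    (Finset.card_biUnion_le_card_mul _ _ _ fun c _ => card_bad c)
  simp only [Finset.card_univ, Fintype.card_pi_const, Fintype.card_fin] at h₁
  have h₂ : g ^ r = g * g ^ (r - 1) := by
    rw [← pow_succ', Nat.sub_add_cancel hr]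
  rw [h₂, ← mul_assoc] at h₁
  have h₃ : 0 < g ^ (r - 1) := pow_pos (by omega) _
  exact absurd (Nat.le_of_mul_le_mul_right h₁ h₃) (by omega)

/-- Any two vertices of a connected induced subgraph lie on an induced path in it. -/
theorem exists_isPathSet {V : Type} {G : SimpleGraph V} {A : Set V}
    (hA : (G.induce A).Connected) {x y : V} (hx : x ∈ A) (hy : y ∈ A) :
    ∃ P ⊆ A, IsPathSet G P ∧ x ∈ P ∧ y ∈ P := by
  obtain ⟨w, hw⟩ := hA.exists_walk_length_eq_dist ⟨x, hx⟩ ⟨y, hy⟩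
  have short : ∀ i j, j ≤ w.length → ∀ d, (G.induce A).dist (w.getVert i) (w.getVert j) ≤ d →
      j ≤ i + d := by
    intro i j hj d hd
    have h₁ := dist_le (w.take i)
    have h₂ := dist_le (w.drop j)
    rw [Walk.take_length] at h₁
    rw [Walk.drop_length] at h₂
    have h₃ := hA.dist_triangle (u := ⟨x, hx⟩) (v := w.getVert i) (w := ⟨y, hy⟩)
    have h₄ := hA.dist_triangle (u := w.getVert i) (v := w.getVert j) (w := ⟨y, hy⟩)
    omega
  let p : Fin (w.length + 1) → V := fun i => (w.getVert i : V)
  have p_inj : Function.Injective p := by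
    intro i j h
    have h' : w.getVert i = w.getVert j := Subtype.ext h
    have h₁ := short i j (by omega) 0 (by simp [h'])
    have h₂ := short j i (by omega) 0 (by simp [h'])
    exact Fin.ext (by omega)
  have p_adj : ∀ i j, G.Adj (p i) (p j) ↔ (pathGraph (w.length + 1)).Adj i j := by
    intro i j
    rw [pathGraph_adj]
    constructor
    · intro h
      have h' : (G.induce A).Adj (w.getVert i) (w.getVert j) := h
      have h₁ := short i j (by omega) 1 (dist_eq_one_iff_adj.mpr h').le
      have h₂ := short j i (by omega) 1 (dist_eq_one_iff_adj.mpr h'.symm).le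
      have h₃ : (i : ℕ) ≠ j := fun e => h.ne (congrArg p (Fin.ext e))
      omega
    · rintro (h | h)
      · have := w.adj_getVert_succ (i := i) (by omega)
        rw [h] at this
        exact this
      · have := w.adj_getVert_succ (i := j) (by omega)
        rw [h] at this
        exact this.symm
  refine ⟨Set.range p, ?_, ⟨w.length, ⟨?_⟩⟩, ⟨0, ?_⟩, ⟨Fin.last _, ?_⟩⟩
  · rintro _ ⟨i, rfl⟩
    exact (w.getVert i).2
  · refine RelIso.symm ⟨Equiv.ofInjective p p_inj, ?_⟩
    intro i j
    exact p_adj i j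
  · simp [p]
  · simp [p]

theorem Anticomplete.mono_left {V : Type} {G : SimpleGraph V} {X X' Y : Set V}
    (h : Anticomplete G X Y) (hX : X' ⊆ X) : Anticomplete G X' Y :=
  ⟨h.1.mono_left hX, fun x hx => h.2 x (hX hx)⟩

theorem IsInducedModel.swap {V : Type} {G : SimpleGraph V} {s t : ℕ}
    {A : Fin s → Set V} {B : Fin t → Set V} (h : IsInducedModel G A B) :
    IsInducedModel G B A :=
  ⟨h.2.1, h.1, h.2.2.2.1, h.2.2.1, fun j i =>
    ⟨(h.2.2.2.2 i j).1.symm, fun h' => (h.2.2.2.2 i j).2 h'.symm⟩⟩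

/-- A connected set that is not anticomplete to many sets `B j` either contains a path that is
not anticomplete to `n` of them, or links each pair from some `r` of them while avoiding the
rest. -/
theorem exists_path_or_linked {V : Type} {G : SimpleGraph V} (r n : ℕ) (hr : 0 < r) {g : ℕ}
    (hg : r * (r * r * (n + 1)) < g) {A : Set V} {B : Fin g → Set V}
    (hA : (G.induce A).Connected)
    (hAB : ∀ j, Disjoint A (B j) ∧ ¬ Anticomplete G A (B j)) :
    (∃ σ : Fin n ↪ Fin g, ∃ P ⊆ A, IsPathSet G P ∧ ∀ k, ¬ Anticomplete G P (B (σ k))) ∨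
    (∃ φ : Fin r ↪ Fin g, ∀ u v, ∃ P ⊆ A, (G.induce P).Connected ∧
      ∀ k, ¬ Anticomplete G P (B (φ k)) ↔ k = u ∨ k = v) := by
  classical
  have touch : ∀ j, ∃ x ∈ A, ∃ y ∈ B j, G.Adj x y := by
    intro j
    by_contra! h
    exact (hAB j).2 ⟨(hAB j).1, h⟩
  choose x hx y hy hxy using touch
  choose P hPA hP hxP hyP using fun j k => exists_isPathSet hA (hx j) (hx k)
  let F : Fin g → Fin g → Finset (Fin g) := fun j k =>
    Finset.univ.filter fun l => ¬ Anticomplete G (P j k) (B l)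
  by_cases hF : ∀ j k, (F j k).card ≤ n
  · right
    obtain ⟨φ, φ_inj, hφ⟩ := exists_free_injection r n g hr hg F hF
    refine ⟨⟨φ, φ_inj⟩, fun u v => ⟨P (φ u) (φ v), hPA _ _, (hP _ _).connected, fun k => ?_⟩⟩
    constructor
    · intro h
      by_contra! hk
      exact hφ u v k hk.1 hk.2 (by simpa [F] using h)
    · rintro (rfl | rfl) h
      · exact h.2 _ (hxP _ _) _ (hy _) (hxy _)
      · exact h.2 _ (hyP _ _) _ (hy _) (hxy _)
  · left
    push Not at hF
    obtain ⟨j, k, h⟩ := hF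
    obtain ⟨e⟩ : Nonempty (Fin n ↪ F j k) :=
      Function.Embedding.nonempty_of_card_le (by simpa using h.le)
    refine ⟨e.trans (Function.Embedding.subtype _), P j k, hPA j k, hP j k, fun l => ?_⟩
    exact (Finset.mem_filter.mp (e l).2).2

/-- The 1-subdivision of a graph, on its vertices and edges. -/
def oneSubdivision {W : Type} (H : SimpleGraph W) : SimpleGraph (W ⊕ H.edgeSet) where
  Adj
    | Sum.inl u, Sum.inr e => u ∈ (e : Sym2 W)
    | Sum.inr e, Sum.inl u => u ∈ (e : Sym2 W)
    | _, _ => False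
  symm := ⟨by rintro (a | a) (b | b) h <;> exact h⟩
  loopless := ⟨by rintro (a | a) h <;> exact h⟩

/-- Any copy of the 1-subdivision of `H` is a subdivision of `H` with paths of length two. -/
theorem isSubdivisionWith_comap_oneSubdivision {U W : Type} (H : SimpleGraph W)
    (e : U ≃ W ⊕ H.edgeSet) :
    IsSubdivisionWith ((oneSubdivision H).comap e) H (fun n => n = 2) := by
  have adj₁ : ∀ ⦃u v⦄ (h : H.Adj u v), ((oneSubdivision H).comap e).Adj
      (e.symm (Sum.inl u)) (e.symm (Sum.inr ⟨s(u, v), h⟩)) := by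
    intro u v h
    simp [oneSubdivision]
  have adj₂ : ∀ ⦃u v⦄ (h : H.Adj u v), ((oneSubdivision H).comap e).Adj
      (e.symm (Sum.inr ⟨s(u, v), h⟩)) (e.symm (Sum.inl v)) := by
    intro u v h
    simp [oneSubdivision]
  refine ⟨{
    b := fun w => e.symm (Sum.inl w)
    b_inj := fun u v h => by simpa using h
    path := fun u v h => Walk.cons (adj₁ h) (Walk.cons (adj₂ h) Walk.nil)
    path_isPath := ?_
    path_len := fun u v h => rfl
    path_symm := ?_
    branch_avoid := ?_
    interiors_anticomplete := ?_
    cover := ?_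
    edges_eq := ?_ }⟩
  · intro u v h
    simp [h.ne]
  · intro u v h
    apply Walk.ext_support
    simp [Sym2.eq_swap]
  · intro u v h w hw
    simpa using hw
  · intro u v u' v' h h' hne x hx hxu hxv y hy hyu hyv
    have hx' : x = e.symm (Sum.inr ⟨s(u, v), h⟩) := by simpa [hxu, hxv] using hx
    have hy' : y = e.symm (Sum.inr ⟨s(u', v'), h'⟩) := by simpa [hyu, hyv] using hy
    subst hx' hy'
    refine ⟨fun h => hne ?_, ?_⟩
    · exact congrArg Subtype.val (Sum.inr.inj (e.symm.injective h))
    · simp [oneSubdivision]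
  · intro x
    obtain ⟨a, rfl⟩ := e.symm.surjective x
    rcases a with w | ⟨z, hz⟩
    · exact Or.inl ⟨w, rfl⟩
    · induction z with
      | h u v => exact Or.inr ⟨u, v, hz, by simp⟩
  · intro x y hxy
    obtain ⟨a, rfl⟩ := e.symm.surjective x
    obtain ⟨b, rfl⟩ := e.symm.surjective y
    rcases a with w | ⟨z, hz⟩ <;> rcases b with w' | ⟨z', hz'⟩
    · simp [oneSubdivision] at hxy
    · have hw : w ∈ z' := by simpa [oneSubdivision] using hxy
      obtain ⟨v, rfl⟩ := hw
      exact ⟨w, v, hz', by simp⟩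
    · have hw : w' ∈ z := by simpa [oneSubdivision] using hxy
      obtain ⟨v, rfl⟩ := hw
      exact ⟨w', v, hz, by simp⟩
    · simp [oneSubdivision] at hxy

/-- Connected sets `B w`, together with for each edge of `H` a connected set touching exactly the
sets `B w` at its ends, form an induced minor model of the 1-subdivision of `H`. -/
theorem hasInducedMinor_oneSubdivision {U V W : Type} {G : SimpleGraph V} {H : SimpleGraph W}
    (e : U ≃ W ⊕ H.edgeSet) {B : W → Set V} {P : H.edgeSet → Set V}
    (hB : ∀ w, (G.induce (B w)).Connected) (hP : ∀ z, (G.induce (P z)).Connected)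
    (hBB : ∀ u v, u ≠ v → Anticomplete G (B u) (B v))
    (hPP : ∀ z z', z ≠ z' → Anticomplete G (P z) (P z'))
    (hPB : ∀ z w, Disjoint (P z) (B w))
    (hinc : ∀ z w, ¬ Anticomplete G (P z) (B w) ↔ w ∈ (z : Sym2 W)) :
    HasInducedMinor G ((oneSubdivision H).comap e) := by
  refine ⟨fun x => Sum.elim B P (e x), fun x => ?_, fun x y hxy => ?_, fun x y hxy => ?_⟩
  · dsimp only
    rcases e x with w | z
    · exact hB w
    · exact hP z
  · have := e.injective.ne hxy
    dsimp only
    generalize e x = a at *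
    generalize e y = b at *
    rcases a with w | z <;> rcases b with w' | z'
    · exact (hBB _ _ (by simpa using this)).1
    · exact (hPB _ _).symm
    · exact hPB _ _
    · exact (hPP _ _ (by simpa using this)).1
  · have := e.injective.ne hxy
    rw [comap_adj]
    dsimp only
    generalize e x = a at *
    generalize e y = b at *
    rcases a with w | z <;> rcases b with w' | z'
    · simpa [oneSubdivision] using hBB _ _ (by simpa using this)
    · exact (hinc z' w).symm.trans (not_congr ⟨Anticomplete.symm, Anticomplete.symm⟩)
    · exact (hinc z w').symm
    · simpa [oneSubdivision] using hPP _ _ (by simpa using this)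

/-- A sufficiently large induced model yields an `A`-linear one with the same kind of sets on the
other side, or a 1-subdivision of a complete graph. -/
theorem exists_linear_side (r m n : ℕ) (hr : 0 < r) :
    ∃ f g : ℕ, 0 < f ∧ 0 < g ∧
      ∀ (V : Type) (G : SimpleGraph V) (A : Fin f → Set V) (B : Fin g → Set V),
        IsInducedModel G A B →
          (∃ (A' : Fin m → Set V) (σ : Fin n → Fin g),
              IsInducedModel G A' (fun k => B (σ k)) ∧ ∀ i, IsPathSet G (A' i)) ∨
          (∃ (k : ℕ) (H : SimpleGraph (Fin k)),
              IsSubdivisionWith H (⊤ : SimpleGraph (Fin r)) (fun n => n = 2) ∧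
              HasInducedMinor G H) := by
  classical
  let E := (⊤ : SimpleGraph (Fin r)).edgeSet
  let g := r * (r * r * (n + 1)) + 1
  let K := (Fin n ↪ Fin g) ⊕ (Fin r ↪ Fin g)
  let N := m + Fintype.card E
  refine ⟨Fintype.card K * N + 1, g, Nat.succ_pos _, Nat.succ_pos _, ?_⟩
  rintro V G A B ⟨hA, hB, hAA, hBB, hAB⟩
  have key : ∀ i, ∃ c : K, Sum.elim
      (fun σ : Fin n ↪ Fin g => ∃ P ⊆ A i, IsPathSet G P ∧ ∀ k, ¬ Anticomplete G P (B (σ k)))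
      (fun φ : Fin r ↪ Fin g => ∀ u v, ∃ P ⊆ A i, (G.induce P).Connected ∧
        ∀ k, ¬ Anticomplete G P (B (φ k)) ↔ k = u ∨ k = v) c := by
    intro i
    rcases exists_path_or_linked r n hr (Nat.lt_succ_self _) (hA i) (hAB i) with ⟨σ, h⟩ | ⟨φ, h⟩
    · exact ⟨Sum.inl σ, h⟩
    · exact ⟨Sum.inr φ, h⟩
  choose c hc using key
  obtain ⟨q, hq⟩ : ∃ q : K, N < (Finset.univ.filter fun i => c i = q).card :=
    Fintype.exists_lt_card_fiber_of_mul_lt_card c (by simp)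
  have select : ∀ (ι : Type) [Fintype ι], Fintype.card ι ≤ N →
      ∃ α : ι → Fin (Fintype.card K * N + 1), Function.Injective α ∧ ∀ x, c (α x) = q := by
    intro ι _ hι
    obtain ⟨α⟩ : Nonempty (ι ↪ Finset.univ.filter fun i => c i = q) :=
      Function.Embedding.nonempty_of_card_le (by rw [Fintype.card_coe]; omega)
    exact ⟨fun x => α x, fun x y h => α.injective (Subtype.ext h),
      fun x => (Finset.mem_filter.mp (α x).2).2⟩
  rcases q with σ | φ
  · left
    obtain ⟨α, α_inj, hα⟩ := select (Fin m) (by simp [N])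
    have hP : ∀ x, ∃ P ⊆ A (α x), IsPathSet G P ∧ ∀ k, ¬ Anticomplete G P (B (σ k)) := by
      intro x
      have := hc (α x)
      rwa [hα x] at this
    choose P hPA hP hPB using hP
    exact ⟨P, σ, ⟨fun x => (hP x).connected, fun k => hB _,
      fun x y hxy => (hAA _ _ (α_inj.ne hxy)).mono (hPA x) (hPA y),
      fun k l hkl => hBB _ _ (σ.injective.ne hkl),
      fun x k => ⟨(hAB _ _).1.mono_left (hPA x), hPB x k⟩⟩, hP⟩
  · right
    obtain ⟨α, α_inj, hα⟩ := select E (by simp [N])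
    have hP : ∀ z : E, ∃ P ⊆ A (α z), (G.induce P).Connected ∧
        ∀ k, ¬ Anticomplete G P (B (φ k)) ↔ k ∈ (z : Sym2 (Fin r)) := by
      intro z
      have h := hc (α z)
      rw [hα z] at h
      obtain ⟨u, v, huv⟩ : ∃ u v, (z : Sym2 (Fin r)) = s(u, v) :=
        Sym2.ind (fun u v => ⟨u, v, rfl⟩) (z : Sym2 (Fin r))
      simpa only [huv, Sym2.mem_iff] using h u v
    choose P hPA hP hPB using hP
    let e := (Fintype.equivFin (Fin r ⊕ E)).symm
    exact ⟨_, _, isSubdivisionWith_comap_oneSubdivision _ e,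
      hasInducedMinor_oneSubdivision e (fun k => hB (φ k)) hP
        (fun k l hkl => hBB _ _ (φ.injective.ne hkl))
        (fun z z' h => (hAA _ _ (α_inj.ne h)).mono (hPA z) (hPA z'))
        (fun z k => (hAB _ _).1.mono_left (hPA z)) hPB⟩

/-- Theorem 7.2: for all positive `r, s, t` there are `f, g` such that
every graph `G` with an induced `(f,g)`-model contains a linear induced `(s,t)`-model,
or has an induced minor isomorphic to a 1-subdivision of `K_r`. -/
theorem stmt11 (r s t : ℕ) (hr : 0 < r) (hs : 0 < s) (ht : 0 < t) :
    ∃ f g : ℕ, 0 < f ∧ 0 < g ∧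
      ∀ (V : Type) [Fintype V] (G : SimpleGraph V)
        (A : Fin f → Set V) (B : Fin g → Set V),
        IsInducedModel G A B →
          (∃ (A' : Fin s → Set V) (B' : Fin t → Set V),
              IsInducedModel G A' B' ∧ (∀ i, IsPathSet G (A' i)) ∧
              ∀ j, IsPathSet G (B' j)) ∨
          (∃ (m : ℕ) (H : SimpleGraph (Fin m)),
              IsSubdivisionWith H (⊤ : SimpleGraph (Fin r)) (fun n => n = 2) ∧
              HasInducedMinor G H) := by
  obtain ⟨f₂, g₂, -, -, h₂⟩ := exists_linear_side r t s hr
  obtain ⟨f₁, g₁, hf₁, hg₁, h₁⟩ := exists_linear_side r g₂ f₂ hr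
  refine ⟨f₁, g₁, hf₁, hg₁, fun V _ G A B hAB => ?_⟩
  rcases h₁ V G A B hAB with ⟨A', σ, hA', hpath⟩ | h
  · rcases h₂ V G _ _ hA'.swap with ⟨B', τ, hB', hpath'⟩ | h
    · exact Or.inl ⟨fun i => A' (τ i), B', hB'.swap, fun i => hpath _, hpath'⟩
    · exact Or.inr h
  · exact Or.inr h
end
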